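/- arXiv:math/0105072 — 3 statements merged into one kernel-verified Lean document; each statement's English description precedes it below -/
import Mathlib

section
/- For all integers s ≥ 0, t ≥ 1, ω' ≥ 2t+s, and every real number x: Σ_{j=0}^{ω'} [(-1)^j / ((ω'-j)! (j+t-s)! (2j+1)!)] · Σ_{p=0}^{2j} (-1)^p binom(2j,p) (x+p-j)^{2j+2t} = 0, where a term with j+t-s < 0 is interpreted as 0 (i.e., 1/(j+t-s)! = 0 for negative arguments). -/
open Finset

namespace FF1

/-- Even divided power. -/
noncomputable def ev (m : ℕ) (y : ℝ) : ℝ := y ^ (2 * m) / (Nat.factorial (2 * m) : ℝ)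

/-- Central difference of order `2j`. -/
noncomputable def S (j : ℕ) (f : ℝ → ℝ) (x : ℝ) : ℝ :=
  ∑ p ∈ range (2 * j + 1), (-1 : ℝ) ^ p * (Nat.choose (2 * j) p : ℝ) * f (x + (p : ℝ) - (j : ℝ))

lemma S_eq (j : ℕ) (f : ℝ → ℝ) (x : ℝ) : S j f x = (fwdDiff (1 : ℝ))^[2 * j] f (x - j) := by
  rw [fwdDiff_iter_eq_sum_shift, S]
  apply sum_congr rfl
  intro p hp
  have hp' : p ≤ 2 * j := by simpa [Nat.lt_succ_iff] using hp
  have h1 : (-1 : ℝ) ^ (2 * j - p) = (-1) ^ p := by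
    rw [neg_one_pow_eq_pow_mod_two, neg_one_pow_eq_pow_mod_two (n := p)]
    congr 1
    omega
  simp only [zsmul_eq_mul, nsmul_eq_mul, mul_one]
  push_cast
  rw [h1]
  congr 2
  ring

lemma S_succ (j : ℕ) (f : ℝ → ℝ) (x : ℝ) :
    S (j + 1) f x = S j (fun y => f (y + 1) - 2 * f y + f (y - 1)) x := by
  rw [S_eq, show 2 * (j + 1) = 2 * j + 2 by ring, Function.iterate_add_apply,
    fwdDiff_iter_eq_sum_shift, S_eq, fwdDiff_iter_eq_sum_shift]
  apply sum_congr rfl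
  intro p _
  congr 1
  simp only [Function.iterate_succ, Function.iterate_zero, Function.comp, id, fwdDiff]
  push_cast
  simp only [nsmul_eq_mul, mul_one]
  rw [show x - (j + 1 : ℝ) + p + 1 + 1 = x - j + p + 1 by ring,
    show x - (j + 1 : ℝ) + p + 1 = x - j + p by ring,
    show x - (j + 1 : ℝ) + p = x - j + p - 1 by ring]
  ring

lemma S_sum (j n : ℕ) (c : ℕ → ℝ) (f : ℕ → ℝ → ℝ) (x : ℝ) :
    S j (fun y => ∑ i ∈ range n, c i * f i y) x = ∑ i ∈ range n, c i * S j (f i) x := by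
  simp only [S, mul_sum]
  rw [sum_comm]
  refine sum_congr rfl fun i _ => sum_congr rfl fun p _ => ?_
  ring

lemma sum_even (m : ℕ) (f : ℕ → ℝ) (h : ∀ i, f (2 * i + 1) = 0) :
    ∑ k ∈ range (2 * m + 1), f k = ∑ i ∈ range (m + 1), f (2 * i) := by
  induction m with
  | zero => simp
  | succ m ih =>
    rw [show 2 * (m + 1) + 1 = 2 * m + 1 + 1 + 1 by ring, sum_range_succ, sum_range_succ, ih,
      sum_range_succ _ (m + 1), h]
    simp [mul_add]

lemma ev_diff (m : ℕ) (y : ℝ) :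
    ev m (y + 1) - 2 * ev m y + ev m (y - 1) =
      ∑ i ∈ range m, (2 / (Nat.factorial (2 * i + 2) : ℝ)) * ev (m - 1 - i) y := by
  have key : ev m (y + 1) + ev m (y - 1) =
      ∑ k ∈ range (2 * m + 1), (1 + (-1) ^ k) / (Nat.factorial k : ℝ) *
        (y ^ (2 * m - k) / (Nat.factorial (2 * m - k) : ℝ)) := by
    rw [ev, ev, add_comm y 1, show y - 1 = -1 + y by ring, add_pow, add_pow, sum_div, sum_div,
      ← sum_add_distrib]
    apply sum_congr rfl
    intro k hk
    have hk' : k ≤ 2 * m := by simpa [Nat.lt_succ_iff] using hk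
    rw [Nat.cast_choose ℝ hk']
    have := Nat.factorial_ne_zero (2 * m)
    have := Nat.factorial_ne_zero k
    have := Nat.factorial_ne_zero (2 * m - k)
    field_simp
    ring
  rw [sum_even, sum_range_succ'] at key
  · have e : ev m (y + 1) - 2 * ev m y + ev m (y - 1) =
      (ev m (y + 1) + ev m (y - 1)) - 2 * ev m y := by ring
    rw [e, key]
    have : (1 + (-1 : ℝ) ^ (2 * 0)) / (Nat.factorial (2 * 0) : ℝ) *
        (y ^ (2 * m - 2 * 0) / (Nat.factorial (2 * m - 2 * 0) : ℝ)) = 2 * ev m y := by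
      simp [ev]; norm_num
    rw [this, add_sub_cancel_right]
    apply sum_congr rfl
    intro i _
    rw [ev, show 2 * m - 2 * (i + 1) = 2 * (m - 1 - i) by omega, pow_mul]
    norm_num [mul_add]
  · intro i
    simp [pow_succ, pow_mul]

lemma S_ev_succ (j m : ℕ) (x : ℝ) :
    S (j + 1) (ev m) x =
      ∑ i ∈ range m, (2 / (Nat.factorial (2 * i + 2) : ℝ)) * S j (ev (m - 1 - i)) x := by
  rw [S_succ]
  simp only [ev_diff]
  exact S_sum j m (fun i => 2 / (Nat.factorial (2 * i + 2) : ℝ)) (fun i => ev (m - 1 - i)) x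

lemma S_ev_zero (j m : ℕ) (x : ℝ) (h : m < j) : S j (ev m) x = 0 := by
  induction j generalizing m with
  | zero => omega
  | succ j ih =>
    rw [S_ev_succ]
    apply sum_eq_zero
    intro i hi
    have := mem_range.1 hi
    rw [ih _ (by omega), mul_zero]

/-- The normalized sums. -/
noncomputable def g (x : ℝ) (t j : ℕ) : ℝ := S j (ev (j + t)) x

lemma g_diff (x : ℝ) (t : ℕ) :
    fwdDiff 1 (g x t) = ∑ i ∈ range t, (2 / (Nat.factorial (2 * i + 4) : ℝ)) • g x (t - 1 - i) := by
  ext j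
  rw [fwdDiff, Finset.sum_apply]
  simp only [Pi.smul_apply, smul_eq_mul]
  rw [g, S_ev_succ, show j + 1 + t = (t + 1) + j by ring, sum_range_add,
    sum_range_succ' _ t]
  have h0 : ∑ i ∈ range j, (2 / (Nat.factorial (2 * (t + 1 + i) + 2) : ℝ)) *
      S j (ev (t + 1 + j - 1 - (t + 1 + i))) x = 0 := by
    apply sum_eq_zero
    intro i hi
    have := mem_range.1 hi
    rw [S_ev_zero _ _ _ (by omega), mul_zero]
  rw [h0, show t + 1 + j - 1 - 0 = j + t by omega]
  have : (2 / (Nat.factorial (2 * 0 + 2) : ℝ)) = 1 := by norm_num [Nat.factorial]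
  rw [this, ← g]
  simp only [one_mul, add_zero, add_sub_cancel_right]
  apply sum_congr rfl
  intro i hi
  have := mem_range.1 hi
  rw [g, show t + 1 + j - 1 - (i + 1) = j + (t - 1 - i) by omega,
    show 2 * (i + 1) + 2 = 2 * i + 4 by ring]

lemma fwdDiff_iter_zero (n : ℕ) : (fwdDiff 1)^[n] (0 : ℕ → ℝ) = 0 := by
  have := fwdDiff_iter_const_smul (M := ℕ) (h := 1) (0 : ℝ) (0 : ℕ → ℝ) n
  simpa using this

lemma g_iter (x : ℝ) (t : ℕ) : ∀ n, t < n → (fwdDiff 1)^[n] (g x t) = 0 := by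
  induction t using Nat.strong_induction_on with
  | _ t ih =>
    intro n hn
    obtain ⟨n, rfl⟩ : ∃ k, n = k + 1 := ⟨n - 1, by omega⟩
    rw [Function.iterate_succ_apply, g_diff, fwdDiff_iter_finsetSum]
    apply sum_eq_zero
    intro i hi
    have := mem_range.1 hi
    rw [fwdDiff_iter_const_smul, ih _ (by omega) n (by omega), smul_zero]

lemma exists_desc (i : ℕ) (a : ℝ) : ∃ P : Polynomial ℝ, P.natDegree ≤ i ∧
    ∀ n : ℕ, ∀ y : ℝ, (n : ℝ) = y + a → P.eval y = (n.descFactorial i : ℝ) := by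
  induction i with
  | zero => exact ⟨1, by simp, by simp⟩
  | succ i ih =>
    obtain ⟨P, hP, h⟩ := ih
    refine ⟨(Polynomial.X + Polynomial.C (a - i)) * P, ?_, ?_⟩
    · refine Polynomial.natDegree_mul_le.trans ?_
      rw [Polynomial.natDegree_X_add_C]
      omega
    · intro n y hy
      simp only [Polynomial.eval_mul, Polynomial.eval_add, Polynomial.eval_X, Polynomial.eval_C]
      rw [h n y hy, Nat.descFactorial_succ]
      rcases le_or_gt i n with hin | hin
      · push_cast [hin]
        rw [hy]; ring
      · rw [Nat.descFactorial_eq_zero_iff_lt.2 hin]; simp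

lemma exists_g (x : ℝ) (t : ℕ) : ∃ P : Polynomial ℝ, P.natDegree ≤ t ∧
    ∀ j : ℕ, P.eval (j : ℝ) = g x t j := by
  choose D hD hD' using fun i => exists_desc i 0
  refine ⟨∑ i ∈ range (t + 1),
    Polynomial.C ((fwdDiff 1)^[i] (g x t) 0 / (Nat.factorial i : ℝ)) * D i, ?_, ?_⟩
  · apply Polynomial.natDegree_sum_le_of_forall_le
    intro i hi
    have := mem_range.1 hi
    exact (Polynomial.natDegree_C_mul_le _ _).trans ((hD i).trans (by omega))
  · intro j
    have h := shift_eq_sum_fwdDiff_iter (1 : ℕ) (g x t) j 0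
    simp only [smul_eq_mul, mul_one, zero_add, nsmul_eq_mul] at h
    rw [Polynomial.eval_finsetSum]
    rw [h]
    have e1 : ∑ k ∈ range (j + 1), (Nat.choose j k : ℝ) * (fwdDiff 1)^[k] (g x t) 0 =
        ∑ k ∈ range (j + 1 + (t + 1)), (Nat.choose j k : ℝ) * (fwdDiff 1)^[k] (g x t) 0 := by
      rw [sum_range_add _ (j + 1) (t + 1)]
      rw [left_eq_add]
      apply sum_eq_zero
      intro i _
      rw [Nat.choose_eq_zero_of_lt (by omega)]; simp
    have e2 : ∑ k ∈ range (t + 1), (Nat.choose j k : ℝ) * (fwdDiff 1)^[k] (g x t) 0 =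
        ∑ k ∈ range (t + 1 + (j + 1)), (Nat.choose j k : ℝ) * (fwdDiff 1)^[k] (g x t) 0 := by
      rw [sum_range_add _ (t + 1) (j + 1)]
      rw [left_eq_add]
      apply sum_eq_zero
      intro i _
      rw [g_iter x t _ (by omega)]; simp
    rw [e1, add_comm (j + 1), ← e2]
    apply sum_congr rfl
    intro i _
    rw [Polynomial.eval_mul, Polynomial.eval_C, hD' i j j (by simp),
      Nat.descFactorial_eq_factorial_mul_choose]
    have := Nat.factorial_ne_zero i
    push_cast
    field_simp

lemma exists_A (t : ℕ) : ∃ A : Polynomial ℝ, A.natDegree ≤ t ∧ ∀ j : ℕ,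
    (Nat.factorial (2 * j + 2 * (t + 1)) : ℝ) * Nat.factorial j =
      A.eval (j : ℝ) * (Nat.factorial (2 * j + 1) * Nat.factorial (j + (t + 1))) := by
  induction t with
  | zero =>
    refine ⟨Polynomial.C 2, by simp, ?_⟩
    intro j
    rw [show 2 * j + 2 * (0 + 1) = 2 * j + 1 + 1 by ring, Nat.factorial_succ (2 * j + 1),
      zero_add, Nat.factorial_succ j]
    push_cast
    simp only [Polynomial.eval_ofNat, Polynomial.eval_C]
    ring
  | succ t ih =>
    obtain ⟨A, hA, h⟩ := ih
    refine ⟨(Polynomial.C 4 * Polynomial.X + Polynomial.C (4 * t + 6 : ℝ)) * A, ?_, ?_⟩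
    · refine Polynomial.natDegree_mul_le.trans ?_
      have := Polynomial.natDegree_linear_le (a := (4 : ℝ)) (b := (4 * t + 6 : ℝ))
      omega
    · intro j
      rw [show 2 * j + 2 * (t + 1 + 1) = 2 * j + 2 * (t + 1) + 1 + 1 by ring,
        Nat.factorial_succ, Nat.factorial_succ (2 * j + 2 * (t + 1)),
        ← add_assoc j (t + 1) 1, Nat.factorial_succ (j + (t + 1))]
      have := h j
      simp only [Polynomial.eval_mul, Polynomial.eval_add, Polynomial.eval_X, Polynomial.eval_C]
      push_cast at *
      linear_combination (2 * j + 2 * (t + 1) + 1 + 1 : ℝ) * (2 * j + 2 * (t + 1) + 1) * this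

lemma sum_poly (n : ℕ) (Q : Polynomial ℝ) (h : Q.natDegree < n) :
    ∑ j ∈ range (n + 1), (-1 : ℝ) ^ j / (Nat.factorial (n - j) * Nat.factorial j : ℝ) *
      Q.eval (j : ℝ) = 0 := by
  have h0 := congrFun (Polynomial.fwdDiff_iter_eq_zero_of_degree_lt h) 0
  rw [fwdDiff_iter_eq_sum_shift] at h0
  have h1 : ∑ j ∈ range (n + 1), (-1 : ℝ) ^ j / (Nat.factorial (n - j) * Nat.factorial j : ℝ) *
      Q.eval (j : ℝ) = ((-1) ^ n / (Nat.factorial n : ℝ)) * ∑ k ∈ range (n + 1),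
        ((-1 : ℤ) ^ (n - k) * n.choose k) • Q.eval (0 + k • (1 : ℝ)) := by
    rw [mul_sum]
    apply sum_congr rfl
    intro k hk
    have hk' : k ≤ n := by simpa [Nat.lt_succ_iff] using hk
    simp only [zsmul_eq_mul, nsmul_eq_mul, mul_one, zero_add]
    push_cast
    rw [Nat.cast_choose ℝ hk']
    have e : (-1 : ℝ) ^ k = (-1) ^ n * (-1) ^ (n - k) := by
      rw [← pow_add, neg_one_pow_eq_pow_mod_two, neg_one_pow_eq_pow_mod_two (n := n + (n - k))]
      congr 1
      omega
    rw [e]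
    have := Nat.factorial_ne_zero n
    have := Nat.factorial_ne_zero k
    have := Nat.factorial_ne_zero (n - k)
    field_simp
  rw [h1, h0]
  simp

end FF1

/-- concrete form of (bb) of Lemma ff1: for `s ≥ 0`, `t ≥ 1`,
`ω' ≥ 2t+s` and every real `x`,
`Σ_{j=0}^{ω'} [(-1)^j/((ω'-j)!(j+t-s)!(2j+1)!)] Σ_{p=0}^{2j} (-1)^p C(2j,p)(x+p-j)^{2j+2t} = 0`,
where `1/(j+t-s)! = 1/Γ(j+t-s+1)` vanishes for `j+t-s < 0`. -/
theorem lemma_ff1_bb (s t ω' : ℕ) (x : ℝ) (ht : 1 ≤ t) (hω : 2 * t + s ≤ ω') :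
    ∑ j ∈ range (ω' + 1),
      ((-1 : ℝ) ^ j /
          ((Nat.factorial (ω' - j) : ℝ) *
            Real.Gamma ((j : ℝ) + (t : ℝ) - (s : ℝ) + 1) * Nat.factorial (2 * j + 1))) *
        ∑ p ∈ range (2 * j + 1),
          (-1 : ℝ) ^ p * (Nat.choose (2 * j) p : ℝ) *
            (x + (p : ℝ) - (j : ℝ)) ^ (2 * j + 2 * t) = 0 := by
  obtain ⟨u, rfl⟩ : ∃ u, t = u + 1 := ⟨t - 1, by omega⟩
  obtain ⟨P, hP, hP'⟩ := FF1.exists_g x (u + 1)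
  obtain ⟨A, hA, hA'⟩ := FF1.exists_A u
  obtain ⟨D, hD, hD'⟩ := FF1.exists_desc s ((u + 1 : ℕ) : ℝ)
  have hdeg : (D * A * P).natDegree < ω' := by
    have h1 := Polynomial.natDegree_mul_le (p := D * A) (q := P)
    have h2 := Polynomial.natDegree_mul_le (p := D) (q := A)
    omega
  rw [← FF1.sum_poly ω' _ hdeg]
  apply sum_congr rfl
  intro j _
  have hg : ∑ p ∈ range (2 * j + 1), (-1 : ℝ) ^ p * (Nat.choose (2 * j) p : ℝ) *
      (x + (p : ℝ) - (j : ℝ)) ^ (2 * j + 2 * (u + 1)) =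
      (Nat.factorial (2 * j + 2 * (u + 1)) : ℝ) * P.eval (j : ℝ) := by
    rw [hP', FF1.g, FF1.S, mul_sum]
    apply sum_congr rfl
    intro p _
    rw [FF1.ev, mul_add 2 j]
    have := Nat.factorial_ne_zero (2 * j + 2 * (u + 1))
    field_simp
  rw [hg, Polynomial.eval_mul, Polynomial.eval_mul, hD' (j + (u + 1)) j (by push_cast; ring)]
  rcases le_or_gt s (j + (u + 1)) with hs | hs
  · have e : (j : ℝ) + ((u + 1 : ℕ) : ℝ) - s + 1 = ((j + (u + 1) - s : ℕ) : ℝ) + 1 := by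
      push_cast [hs]; ring
    rw [e, Real.Gamma_nat_eq_factorial]
    have h1 := hA' j
    have h2 : (Nat.factorial (j + (u + 1) - s) : ℝ) * (Nat.descFactorial (j + (u + 1)) s : ℝ) =
      Nat.factorial (j + (u + 1)) := by exact_mod_cast Nat.factorial_mul_descFactorial hs
    rw [← h2] at h1
    have a1 : (Nat.factorial j : ℝ) ≠ 0 := by exact_mod_cast Nat.factorial_ne_zero _
    have a2 : (Nat.factorial (ω' - j) : ℝ) ≠ 0 := by exact_mod_cast Nat.factorial_ne_zero _
    have a3 : (Nat.factorial (2 * j + 1) : ℝ) ≠ 0 := by exact_mod_cast Nat.factorial_ne_zero _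
    have a4 : (Nat.factorial (j + (u + 1) - s) : ℝ) ≠ 0 := by
      exact_mod_cast Nat.factorial_ne_zero _
    generalize (Nat.factorial (2 * j + 2 * (u + 1)) : ℝ) = F at *
    generalize (Nat.factorial (j + (u + 1) - s) : ℝ) = G at *
    generalize (Nat.factorial (2 * j + 1) : ℝ) = H at *
    generalize (Nat.factorial j : ℝ) = J at *
    rw [div_mul_eq_mul_div, div_mul_eq_mul_div,
      div_eq_div_iff (by positivity) (by positivity)]
    linear_combination (-1 : ℝ) ^ j * Polynomial.eval (j : ℝ) P * (Nat.factorial (ω' - j) : ℝ) * h1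
  · have e : (j : ℝ) + ((u + 1 : ℕ) : ℝ) - s + 1 = -((s - (j + (u + 1)) - 1 : ℕ) : ℝ) := by
      obtain ⟨k, rfl⟩ := Nat.exists_eq_add_of_lt hs
      rw [show j + (u + 1) + k + 1 - (j + (u + 1)) - 1 = k by omega]
      push_cast; ring
    rw [e, Real.Gamma_neg_nat_eq_zero, Nat.descFactorial_eq_zero_iff_lt.2 hs]
    simp
end

section
/- For all integers s ≥ 0, t ≥ 0 and ω' ≥ 2t+s: Σ_{j=0}^{ω'} [(-1)^j / ((ω'-j)! (j+t-s)! (2j+2)!)] · Σ_{p=0}^{2j+1} (-1)^p binom(2j+1,p) (j + 1/2 - p)^{2j+2t+1} = (t-s)_s (2^{1-2t} - 1) B_{2t} / (2 (ω'+1)! · t!), where (t-s)_s = (t-s)(t-s+1)⋯(t-1) is the Pochhammer symbol (with (x)_0 = 1) and a term with j+t-s < 0 is interpreted as 0. -/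
open Finset

namespace FF2

open PowerSeries in
/-- `1/P = 2 b(x/2) - b(x)` -/
noncomputable def V : PowerSeries ℝ :=
  2 * rescale (1/2 : ℝ) (bernoulliPowerSeries ℝ) - bernoulliPowerSeries ℝ

open PowerSeries in
noncomputable def S : PowerSeries ℝ :=
  rescale (1/2 : ℝ) (exp ℝ) - rescale (-1/2 : ℝ) (exp ℝ)

open PowerSeries in
noncomputable def P : PowerSeries ℝ := mk fun n => coeff (n + 1) S

open PowerSeries in
lemma X_mul_P : X * P = S := by
  ext n
  cases n with
  | zero =>
    rw [S, map_sub, coeff_rescale, coeff_rescale]; simp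
  | succ n => rw [coeff_succ_X_mul, P, coeff_mk]

open PowerSeries in
lemma X_sq_dvd : (X : PowerSeries ℝ) ^ 2 ∣ P - 1 := by
  rw [X_pow_dvd_iff]
  intro m hm
  interval_cases m
  · simp [P, S, coeff_exp]; norm_num
  · simp [P, S, coeff_exp, coeff_one]; norm_num

open PowerSeries in
lemma S_mul_V : S * V = X := by
  have h1 := bernoulliPowerSeries_mul_exp_sub_one ℝ
  have h2 := congrArg (rescale (1/2 : ℝ)) h1
  have h3 : rescale (1/2 : ℝ) (exp ℝ) * rescale (1/2 : ℝ) (exp ℝ) = exp ℝ := by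
    rw [exp_mul_exp_eq_exp_add]; norm_num
  have h4 : rescale (1/2 : ℝ) (exp ℝ) * rescale (-1/2 : ℝ) (exp ℝ) = 1 := by
    rw [exp_mul_exp_eq_exp_add]; norm_num
  have h5 : 2 * rescale (1/2 : ℝ) (X : PowerSeries ℝ) = X := by
    have : (2 : PowerSeries ℝ) = C 2 := (map_ofNat (C (R := ℝ)) 2).symm
    rw [rescale_X, ← mul_assoc, this, ← map_mul]; norm_num
  rw [map_mul, map_sub, map_one] at h2
  unfold S V
  set E := rescale (1/2 : ℝ) (exp ℝ)
  set E' := rescale (-1/2 : ℝ) (exp ℝ)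
  set bh := rescale (1/2 : ℝ) (bernoulliPowerSeries ℝ)
  set b := bernoulliPowerSeries ℝ
  set xh := rescale (1/2 : ℝ) (X : PowerSeries ℝ)
  have h6 : E * ((E - E') * (2 * bh - b)) = E * X := by
    rw [← h3] at h1
    linear_combination (2 * (E + 1)) * h2 - h1 - (2 * bh - b) * h4 + (E+1) * h5
  have : E' * (E * ((E - E') * (2 * bh - b))) = E' * (E * X) := by rw [h6]
  linear_combination this - ((E - E') * (2 * bh - b) - X) * h4

open PowerSeries in
lemma P_mul_V : P * V = 1 := by
  have h : X * (P * V) = X * 1 := by rw [← mul_assoc, X_mul_P, S_mul_V, mul_one]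
  exact mul_left_cancel₀ X_ne_zero h

open PowerSeries in
lemma coeff_V (n : ℕ) : coeff n V = (2 * (1/2 : ℝ) ^ n - 1) * ((bernoulli n : ℚ) : ℝ) / n.factorial := by
  have : (2 : PowerSeries ℝ) = C 2 := (map_ofNat (C (R := ℝ)) 2).symm
  rw [V, this, map_sub, coeff_C_mul, coeff_rescale, bernoulliPowerSeries, coeff_mk]
  simp
  ring

open PowerSeries in
lemma rescale_exp_pow (a : ℝ) (k : ℕ) :
    (rescale a (exp ℝ)) ^ k = rescale (k * a) (exp ℝ) := by
  rw [← map_pow, exp_pow_eq_rescale_exp, rescale_rescale]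

open PowerSeries in
lemma coeff_P_pow (m d : ℕ) :
    coeff d (P ^ m) * (d + m).factorial = ∑ p ∈ range (m + 1),
      (-1 : ℝ) ^ p * (Nat.choose m p : ℝ) * ((m : ℝ) / 2 - p) ^ (d + m) := by
  rw [← coeff_X_pow_mul (P ^ m) m d, ← mul_pow, X_mul_P, S, sub_eq_neg_add, add_pow, map_sum,
    sum_mul]
  refine sum_congr rfl fun p hp => ?_
  have hp' : p ≤ m := by simpa [Nat.lt_succ_iff] using hp
  have hC : ((-1 : PowerSeries ℝ)) ^ p * ((m.choose p : ℕ) : PowerSeries ℝ)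
      = C ((-1 : ℝ) ^ p * (m.choose p : ℝ)) := by simp
  have : (-rescale (-1/2 : ℝ) (exp ℝ)) ^ p * rescale (1/2 : ℝ) (exp ℝ) ^ (m - p) * (m.choose p : ℕ)
      = C ((-1 : ℝ) ^ p * (m.choose p : ℝ)) * rescale ((m : ℝ) / 2 - p) (exp ℝ) := by
    rw [neg_pow, rescale_exp_pow, rescale_exp_pow, mul_assoc ((-1) ^ p), exp_mul_exp_eq_exp_add, ← hC]
    have : ((p : ℝ) * (-1/2) + ((m - p : ℕ) : ℝ) * (1/2)) = (m : ℝ) / 2 - p := by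
      rw [Nat.cast_sub hp']; ring
    rw [this]; ring
  rw [this, coeff_C_mul, coeff_rescale, coeff_exp]
  have := Nat.cast_ne_zero (R := ℝ).2 (Nat.factorial_ne_zero (d + m))
  simp
  field_simp

open PowerSeries in
lemma coeff_zero_of {U : PowerSeries ℝ} (h : (X : PowerSeries ℝ) ^ 2 ∣ U) {k t : ℕ} (hk : t < k)
    (W : PowerSeries ℝ) : coeff (2 * t) (U ^ k * W) = 0 := by
  have : (X : PowerSeries ℝ) ^ (2 * k) ∣ U ^ k * W := by
    rw [pow_mul]; exact (pow_dvd_pow_of_dvd h k).mul_right W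
  exact X_pow_dvd_iff.1 this _ (by omega)

lemma desc_neg_one (k : ℕ) : ∏ j ∈ range k, ((-1 : ℝ) - j) = (-1) ^ k * k.factorial := by
  induction k with
  | zero => simp
  | succ k ih => rw [prod_range_succ, ih, Nat.factorial_succ]; push_cast; ring

lemma exists_c (t : ℕ) : ∃ c : Polynomial ℝ, c.natDegree ≤ t ∧
    (∀ n : ℕ, c.eval (n : ℝ) = PowerSeries.coeff (2 * t) (P ^ n)) ∧
    c.eval (-1) = PowerSeries.coeff (2 * t) V := by
  refine ⟨∑ k ∈ range (t + 1), Polynomial.C (PowerSeries.coeff (2 * t) ((P - 1) ^ k) / (k.factorial : ℝ))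
    * descPochhammer ℝ k, ?_, ?_, ?_⟩
  · refine Polynomial.natDegree_sum_le_of_forall_le _ _ fun k hk => ?_
    refine (Polynomial.natDegree_C_mul_le _ _).trans ?_
    rw [descPochhammer_natDegree]
    simpa [Nat.lt_succ_iff] using hk
  · intro n
    have h1 : PowerSeries.coeff (2 * t) (P ^ n) = ∑ k ∈ range (n + 1),
        PowerSeries.coeff (2 * t) ((P - 1) ^ k) * (n.choose k : ℝ) := by
      conv_lhs => rw [← sub_add_cancel P 1, add_pow, map_sum]
      refine sum_congr rfl fun k _ => ?_
      have : ((n.choose k : ℕ) : PowerSeries ℝ) = PowerSeries.C (n.choose k : ℝ) := by simp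
      rw [one_pow, mul_one, this, PowerSeries.coeff_mul_C]
    have h2 : ∑ k ∈ range (n + 1), PowerSeries.coeff (2 * t) ((P - 1) ^ k) * (n.choose k : ℝ)
        = ∑ k ∈ range (n + t + 1), PowerSeries.coeff (2 * t) ((P - 1) ^ k) * (n.choose k : ℝ) := by
      refine sum_subset (range_subset_range.2 (by omega)) fun k _ hk => ?_
      rw [Nat.choose_eq_zero_of_lt (by simpa using hk)]; simp
    have h3 : ∑ k ∈ range (t + 1), PowerSeries.coeff (2 * t) ((P - 1) ^ k) * (n.choose k : ℝ)
        = ∑ k ∈ range (n + t + 1), PowerSeries.coeff (2 * t) ((P - 1) ^ k) * (n.choose k : ℝ) := by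
      refine sum_subset (range_subset_range.2 (by omega)) fun k _ hk => ?_
      have := coeff_zero_of X_sq_dvd (k := k) (t := t) (by simpa using hk) 1
      rw [mul_one] at this
      rw [this, zero_mul]
    rw [h1, h2, ← h3, Polynomial.eval_finsetSum]
    refine sum_congr rfl fun k _ => ?_
    rw [Polynomial.eval_mul, Polynomial.eval_C, descPochhammer_eval_eq_descFactorial,
      Nat.descFactorial_eq_factorial_mul_choose]
    have := Nat.cast_ne_zero (R := ℝ).2 (Nat.factorial_ne_zero k)
    push_cast
    field_simp
  · have hg := geom_sum_mul_neg (1 - P) (t + 1)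
    have h1 : V = ∑ k ∈ range (t + 1), (1 - P) ^ k + (1 - P) ^ (t + 1) * V := by
      have := congrArg (· * V) hg
      simp only [sub_sub_cancel] at this
      rw [mul_assoc, P_mul_V] at this
      linear_combination -this
    have hd : (PowerSeries.X : PowerSeries ℝ) ^ 2 ∣ 1 - P := by
      rw [← neg_sub]; exact (dvd_neg).2 X_sq_dvd
    rw [h1, map_add, coeff_zero_of hd (Nat.lt_succ_self t), add_zero, map_sum,
      Polynomial.eval_finsetSum]
    refine sum_congr rfl fun k _ => ?_
    have hC : ((-1 : PowerSeries ℝ)) ^ k = PowerSeries.C ((-1 : ℝ) ^ k) := by simp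
    rw [Polynomial.eval_mul, Polynomial.eval_C, descPochhammer_eval_eq_prod_range, desc_neg_one,
      ← neg_sub P 1, neg_pow (P - 1), hC, PowerSeries.coeff_C_mul]
    have := Nat.cast_ne_zero (R := ℝ).2 (Nat.factorial_ne_zero k)
    field_simp

lemma prod_gamma (n s : ℕ) :
    ∏ i ∈ range s, ((n : ℝ) - i) = n.factorial / Real.Gamma ((n : ℝ) - s + 1) := by
  rw [← descPochhammer_eval_eq_prod_range, descPochhammer_eval_eq_descFactorial]
  rcases le_or_gt s n with h | h
  · rw [← Nat.cast_sub h, Real.Gamma_nat_eq_factorial, ← Nat.factorial_mul_descFactorial h]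
    have := Nat.cast_ne_zero (R := ℝ).2 (Nat.factorial_ne_zero (n - s))
    push_cast
    field_simp
  · rw [Nat.descFactorial_of_lt h]
    obtain ⟨k, rfl⟩ := Nat.exists_eq_add_of_lt h
    have : ((n : ℝ) - ((n + k + 1 : ℕ) : ℝ) + 1) = -(k : ℝ) := by push_cast; ring
    rw [this, Real.Gamma_neg_nat_eq_zero]; simp

lemma fact_split (j t : ℕ) : ((2 * j + 2 * t + 1).factorial : ℝ) * j.factorial =
    (∏ i ∈ range t, (2 * (j : ℝ) + 3 + 2 * i)) * 2 ^ t * (j + t).factorial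
      * (2 * j + 1).factorial := by
  induction t with
  | zero => simp; ring
  | succ t ih =>
    have e1 : 2 * j + 2 * (t + 1) + 1 = (2 * j + 2 * t + 1) + 1 + 1 := by ring
    rw [e1, Nat.factorial_succ, Nat.factorial_succ, prod_range_succ, ← add_assoc j t 1,
      Nat.factorial_succ (j + t)]
    push_cast
    linear_combination (2 * (j : ℝ) + 2 * t + 3) * (2 * j + 2 * t + 2) * ih

lemma fact_split' (t : ℕ) : ((2 * t).factorial : ℝ) =
    (∏ i ∈ range t, (2 * (-1 : ℝ) + 3 + 2 * i)) * 2 ^ t * t.factorial := by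
  induction t with
  | zero => simp
  | succ t ih =>
    have e1 : 2 * (t + 1) = (2 * t) + 1 + 1 := by ring
    rw [e1, Nat.factorial_succ, Nat.factorial_succ, prod_range_succ, Nat.factorial_succ t]
    push_cast
    linear_combination (2 * (t : ℝ) + 2) * (2 * t + 1) * ih

lemma diff_sum (Q : Polynomial ℝ) (w : ℕ) (h : Q.natDegree ≤ w) :
    ∑ j ∈ range (w + 1), (-1 : ℝ) ^ j * ((w + 1).choose (j + 1) : ℝ) * Q.eval (j : ℝ)
      = Q.eval (-1) := by
  have h0 := congrFun (Polynomial.fwdDiff_iter_eq_zero_of_degree_lt (Nat.lt_succ_of_le h)) (-1)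
  rw [fwdDiff_iter_eq_sum_shift, sum_range_succ'] at h0
  have h1 := congrArg (fun x => (-1 : ℝ) ^ w * x) h0
  simp only [Pi.zero_apply, mul_zero, mul_add, mul_sum] at h1
  have h2 : ∀ j ∈ range (w + 1), (-1 : ℝ) ^ w *
      (((-1 : ℤ) ^ (w.succ - (j + 1)) * (w.succ.choose (j + 1) : ℤ)) •
        Q.eval (-1 + (j + 1) • (1 : ℝ)))
      = (-1 : ℝ) ^ j * ((w + 1).choose (j + 1) : ℝ) * Q.eval (j : ℝ) := by
    intro j hj
    obtain ⟨k, rfl⟩ := Nat.exists_eq_add_of_le (show j ≤ w by simpa [Nat.lt_succ_iff] using hj)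
    have e : (j + k).succ - (j + 1) = k := by omega
    have e2 : (-1 + (j + 1) • (1 : ℝ)) = j := by simp
    have e3 : (-1 : ℝ) ^ k * (-1) ^ k = 1 := by rw [← mul_pow]; simp
    rw [e, e2, zsmul_eq_mul]
    push_cast
    rw [pow_add]
    linear_combination (-1) ^ j * ((j + k + 1).choose (j + 1) : ℝ) * Q.eval (j : ℝ) * e3
  rw [sum_congr rfl h2] at h1
  have e3 : (-1 : ℝ) ^ w * (-1) ^ w = 1 := by rw [← mul_pow]; simp
  simp [pow_succ] at h1
  linear_combination h1 + Q.eval (-1) * e3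

end FF2

theorem lemma_ff2_e2 (s t ω' : ℕ) (hω : 2 * t + s ≤ ω') :
    ∑ j ∈ range (ω' + 1),
      ((-1 : ℝ) ^ j /
          ((Nat.factorial (ω' - j) : ℝ) *
            Real.Gamma ((j : ℝ) + (t : ℝ) - (s : ℝ) + 1) * Nat.factorial (2 * j + 2))) *
        ∑ p ∈ range (2 * j + 2),
          (-1 : ℝ) ^ p * (Nat.choose (2 * j + 1) p : ℝ) *
            ((j : ℝ) + 1 / 2 - (p : ℝ)) ^ (2 * j + 2 * t + 1) =
      (∏ i ∈ range s, ((t : ℝ) - (s : ℝ) + (i : ℝ))) *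
        ((2 : ℝ) ^ (1 - 2 * (t : ℤ)) - 1) * ((bernoulli (2 * t) : ℚ) : ℝ) /
          (2 * Nat.factorial (ω' + 1) * Nat.factorial t) := by
  obtain ⟨c, hc, hcn, hc1⟩ := FF2.exists_c t
  let Q : Polynomial ℝ := Polynomial.C (2 ^ t / 2) *
    (∏ i ∈ range t, (Polynomial.C 2 * Polynomial.X + Polynomial.C (3 + 2 * (i : ℝ)))) *
    (∏ i ∈ range s, (Polynomial.C 1 * Polynomial.X + Polynomial.C ((t : ℝ) - i))) *
    c.comp (Polynomial.C 2 * Polynomial.X + Polynomial.C 1)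
  have hlin : ∀ a b : ℝ, (Polynomial.C a * Polynomial.X + Polynomial.C b).natDegree ≤ 1 :=
    fun a b => Polynomial.natDegree_linear_le
  have hprod : ∀ (n : ℕ) (a : ℝ) (b : ℕ → ℝ),
      (∏ i ∈ range n, (Polynomial.C a * Polynomial.X + Polynomial.C (b i))).natDegree ≤ n := by
    intro n a b
    refine (Polynomial.natDegree_prod_le _ _).trans ?_
    refine (sum_le_sum fun i _ => hlin a (b i)).trans ?_
    simp
  have hQdeg : Q.natDegree ≤ ω' := by
    have h1 : Q.natDegree ≤ 0 + t + s + t * 1 := by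
      refine Polynomial.natDegree_mul_le_of_le (Polynomial.natDegree_mul_le_of_le
        (Polynomial.natDegree_mul_le_of_le (by simp) (hprod _ _ _)) (hprod _ _ _)) ?_
      exact Polynomial.natDegree_comp_le.trans (Nat.mul_le_mul hc (hlin _ _))
    omega
  have hQe : ∀ x : ℝ, Q.eval x = 2 ^ t / 2 * (∏ i ∈ range t, (2 * x + 3 + 2 * (i : ℝ))) *
      (∏ i ∈ range s, (x + t - i)) * c.eval (2 * x + 1) := by
    intro x
    simp only [Q, Polynomial.eval_mul, Polynomial.eval_prod, Polynomial.eval_comp,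
      Polynomial.eval_add, Polynomial.eval_C, Polynomial.eval_X]
    congr 3
    · exact prod_congr rfl fun i _ => by ring
    · exact funext fun i => by ring
  have hfac : ∀ n : ℕ, (n.factorial : ℝ) ≠ 0 := fun n =>
    Nat.cast_ne_zero.2 (Nat.factorial_ne_zero n)
  have key := FF2.diff_sum Q ω' hQdeg
  have hterm : ∀ j ∈ range (ω' + 1), ((-1 : ℝ) ^ j /
          ((Nat.factorial (ω' - j) : ℝ) *
            Real.Gamma ((j : ℝ) + (t : ℝ) - (s : ℝ) + 1) * Nat.factorial (2 * j + 2))) *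
        ∑ p ∈ range (2 * j + 2),
          (-1 : ℝ) ^ p * (Nat.choose (2 * j + 1) p : ℝ) *
            ((j : ℝ) + 1 / 2 - (p : ℝ)) ^ (2 * j + 2 * t + 1) =
      ((-1 : ℝ) ^ j * ((ω' + 1).choose (j + 1) : ℝ) * Q.eval (j : ℝ)) / (ω' + 1).factorial := by
    intro j hj
    have hj' : j ≤ ω' := by simpa [Nat.lt_succ_iff] using hj
    have hs : ∑ p ∈ range (2 * j + 2),
          (-1 : ℝ) ^ p * (Nat.choose (2 * j + 1) p : ℝ) *
            ((j : ℝ) + 1 / 2 - (p : ℝ)) ^ (2 * j + 2 * t + 1) =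
        c.eval (2 * (j : ℝ) + 1) * (2 * j + 2 * t + 1).factorial := by
      have h := FF2.coeff_P_pow (2 * j + 1) (2 * t)
      rw [← hcn] at h
      have e : 2 * t + (2 * j + 1) = 2 * j + 2 * t + 1 := by ring
      rw [e] at h
      push_cast at h
      rw [h]
      refine sum_congr rfl fun p _ => ?_
      congr 2
      ring
    have hg := FF2.prod_gamma (j + t) s
    push_cast at hg
    have hf := FF2.fact_split j t
    have hch : ((ω' + 1).choose (j + 1) : ℝ) =
        (ω' + 1).factorial / ((j + 1).factorial * (ω' - j).factorial) := by
      rw [Nat.cast_choose ℝ (by omega)]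
      congr 4
      omega
    have hf' : ((2 * j + 2 * t + 1).factorial : ℝ) = 
      (∏ i ∈ range t, (2 * (j : ℝ) + 3 + 2 * i)) * 2 ^ t * (j + t).factorial
      * (2 * j + 1).factorial / j.factorial := by
      rw [← hf]; field_simp [hfac j]
    rw [hs, hQe, hg, hch, hf', Nat.factorial_succ (2 * j + 1), Nat.factorial_succ j]
    have h1 := hfac j
    have h2 := hfac (2 * j + 1)
    have h3 := hfac (ω' - j)
    have h4 := hfac (ω' + 1)
    have h5 : (j : ℝ) + 1 ≠ 0 := by positivity
    have h6 : (2 * (j : ℝ) + 1 + 1) = 2 * (j + 1) := by ring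
    push_cast
    rw [h6]
    simp only [div_eq_mul_inv, mul_inv]
    generalize (Real.Gamma ((j : ℝ) + t - s + 1))⁻¹ = G
    field_simp
  rw [sum_congr rfl hterm, ← sum_div, key, hQe]
  have e1 : (2 * (-1 : ℝ) + 1) = -1 := by norm_num
  have e2 : ∏ i ∈ range s, (-1 + (t : ℝ) - i) = ∏ i ∈ range s, ((t : ℝ) - s + i) := by
    rw [← prod_range_reflect]
    refine prod_congr rfl fun i hi => ?_
    have : i + 1 ≤ s := by simpa using hi
    rw [Nat.sub_sub, Nat.add_comm 1 i, Nat.cast_sub this]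
    push_cast; ring
  have e3 : (2 : ℝ) ^ (1 - 2 * (t : ℤ)) = 2 * (1 / 2 : ℝ) ^ (2 * t) := by
    rw [zpow_sub₀ (by norm_num)]
    have : (2 : ℝ) ^ (2 * (t : ℤ)) = 2 ^ (2 * t) := by exact_mod_cast rfl
    rw [this, one_div, inv_pow]; simp [div_eq_mul_inv]
  rw [e1, e2, hc1, FF2.coeff_V, e3, FF2.fact_split' t]
  have h1 := hfac t
  have h4 := hfac (ω' + 1)
  have h5 : ∏ i ∈ range t, (2 * (-1 : ℝ) + 3 + 2 * (i : ℝ)) ≠ 0 := by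
    refine prod_ne_zero_iff.2 fun i _ => ?_
    have : (0 : ℝ) ≤ i := Nat.cast_nonneg i
    linarith
  generalize (∏ i ∈ range t, (2 * (-1 : ℝ) + 3 + 2 * (i : ℝ))) = A at *
  generalize (2 * (1 / 2 : ℝ) ^ (2 * t) - 1) = B at *
  field_simp
end

section
/- For all integers s ≥ 0, t ≥ 1 and ω' ≥ 2t+s, there exist polynomials Q_0, …, Q_s with real coefficients such that for all real z: Σ_{j=0}^{ω'} (-1)^j (2j+2t)! z^j / ((ω'-j)! (j+t-s)! (2j+1)!) = Σ_{k=0}^{s} Q_k(z) · F_k(z), where F_k(z) = Σ_{m=0}^{ω'-k} [ (k-ω')_m (1/2+t+k)_m / (3/2+k)_m ] z^m / m! is the terminating hypergeometric sum ₂F₁(-ω'+k, 1/2+t+k; 3/2+k; z), and a term with j+t-s < 0 is interpreted as 0. -/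
open Finset

/-- The Pochhammer symbol `(a)_m = a(a+1)⋯(a+m-1)`. -/
noncomputable def poch (a : ℝ) (m : ℕ) : ℝ := ∏ i ∈ Finset.range m, (a + (i : ℝ))

theorem poch_succ' (a : ℝ) (m : ℕ) : poch a (m + 1) = poch a m * (a + m) := by
  simp [poch, Finset.prod_range_succ]

theorem poch_add' (a : ℝ) (k m : ℕ) : poch a (k + m) = poch a k * poch (a + k) m := by
  simp only [poch, Finset.prod_range_add]
  congr 1
  apply Finset.prod_congr rfl
  intros
  push_cast
  ring

theorem poch_pos' (a : ℝ) (ha : 0 < a) (m : ℕ) : 0 < poch a m :=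
  Finset.prod_pos fun i _ => by positivity

theorem aux_neg (w j : ℕ) (h : j ≤ w) :
    poch (-(w : ℝ)) j * (Nat.factorial (w - j) : ℝ) = (-1 : ℝ) ^ j * Nat.factorial w := by
  induction j with
  | zero => simp [poch]
  | succ j ih =>
    have h1 := ih (by omega)
    obtain ⟨d, rfl⟩ : ∃ d, w = j + 1 + d := ⟨w - (j + 1), by omega⟩
    have e1 : j + 1 + d - j = d + 1 := by omega
    have e2 : j + 1 + d - (j + 1) = d := by omega
    rw [e1, Nat.factorial_succ] at h1
    rw [e2, poch_succ', pow_succ]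
    push_cast at h1 ⊢
    linear_combination (-1) * h1

theorem aux_fact (t j : ℕ) :
    (Nat.factorial (2 * j + 2 * t) : ℝ) * Nat.factorial t * (poch (3 / 2) j * Nat.factorial j) =
      Nat.factorial (2 * t) * poch (1 / 2 + (t : ℝ)) j *
        (Nat.factorial (j + t) * Nat.factorial (2 * j + 1)) := by
  induction j with
  | zero => simp [poch]
  | succ j ih =>
    have e1 : 2 * (j + 1) + 2 * t = 2 * j + 2 * t + 1 + 1 := by ring
    have e2 : j + 1 + t = j + t + 1 := by ring
    have e3 : 2 * (j + 1) + 1 = 2 * j + 1 + 1 + 1 := by ring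
    rw [e1, e2, e3]
    simp only [poch_succ', Nat.factorial_succ] at ih ⊢
    push_cast at ih ⊢
    linear_combination ((2 * j + 2 * t + 2 : ℝ) * (2 * j + 2 * t + 1) * (3 / 2 + j) * (j + 1)) * ih

theorem aux_gamma (s t j : ℕ) :
    (Real.Gamma ((j : ℝ) + (t : ℝ) - (s : ℝ) + 1))⁻¹ =
      ((j + t).descFactorial s : ℝ) / Nat.factorial (j + t) := by
  rcases Nat.lt_or_ge (j + t) s with h | h
  · obtain ⟨d, rfl⟩ : ∃ d, s = j + t + 1 + d := ⟨s - (j + t + 1), by omega⟩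
    rw [Nat.descFactorial_eq_zero_iff_lt.2 h]
    have : ((j : ℝ) + (t : ℝ) - ((j + t + 1 + d : ℕ) : ℝ) + 1) = -(d : ℝ) := by
      push_cast; ring
    rw [this, Real.Gamma_neg_nat_eq_zero]
    simp
  · obtain ⟨d, hd⟩ : ∃ d, j + t = s + d := ⟨j + t - s, by omega⟩
    have h1 : ((j : ℝ) + (t : ℝ) - (s : ℝ) + 1) = (d : ℝ) + 1 := by
      have : ((j + t : ℕ) : ℝ) = ((s + d : ℕ) : ℝ) := by rw [hd]
      push_cast at this
      linarith
    rw [h1, Real.Gamma_nat_eq_factorial]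
    have h2 := Nat.factorial_mul_descFactorial h
    rw [show j + t - s = d by omega] at h2
    have h3 : (Nat.factorial d : ℝ) * ((j + t).descFactorial s : ℝ) = Nat.factorial (j + t) := by
      exact_mod_cast h2
    have := Nat.factorial_pos d
    have := Nat.factorial_pos (j + t)
    field_simp
    linarith

/-- coefficients of `F_0` -/
noncomputable def coefA (t w j : ℕ) : ℝ :=
  poch (-(w : ℝ)) j * poch (1 / 2 + (t : ℝ)) j / (poch (3 / 2) j * Nat.factorial j)

theorem aux_term (s t w j : ℕ) (h : j ≤ w) (z : ℝ) :
    ((-1 : ℝ) ^ j * (Nat.factorial (2 * j + 2 * t) : ℝ) * z ^ j /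
          ((Nat.factorial (w - j) : ℝ) *
            Real.Gamma ((j : ℝ) + (t : ℝ) - (s : ℝ) + 1) * Nat.factorial (2 * j + 1))) =
    (Nat.factorial (2 * t) / (Nat.factorial t * Nat.factorial w) : ℝ) *
      ((j + t).descFactorial s : ℝ) * (coefA t w j * z ^ j) := by
  have h1 := aux_neg w j h
  have h2 := aux_fact t j
  have h3 := aux_gamma s t j
  have p1 : (0 : ℝ) < Nat.factorial (w - j) := by exact_mod_cast Nat.factorial_pos _
  have p2 : (0 : ℝ) < Nat.factorial (2 * j + 1) := by exact_mod_cast Nat.factorial_pos _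
  have p3 : (0 : ℝ) < Nat.factorial t := by exact_mod_cast Nat.factorial_pos _
  have p4 : (0 : ℝ) < Nat.factorial w := by exact_mod_cast Nat.factorial_pos _
  have p5 : (0 : ℝ) < Nat.factorial j := by exact_mod_cast Nat.factorial_pos _
  have p6 : (0 : ℝ) < Nat.factorial (j + t) := by exact_mod_cast Nat.factorial_pos _
  have p7 := poch_pos' (3 / 2) (by norm_num) j
  have e1 : (-1 : ℝ) ^ j / (Nat.factorial (w - j) : ℝ) = poch (-(w : ℝ)) j / Nat.factorial w := by
    rw [div_eq_div_iff p1.ne' p4.ne']; linarith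
  have e2 : (Nat.factorial (2 * j + 2 * t) : ℝ) / (Nat.factorial (j + t) * Nat.factorial (2 * j + 1))
      = Nat.factorial (2 * t) * poch (1 / 2 + (t : ℝ)) j /
        (Nat.factorial t * (poch (3 / 2) j * Nat.factorial j)) := by
    rw [div_eq_div_iff (by positivity) (by positivity)]; linarith
  calc _ = ((-1 : ℝ) ^ j / (Nat.factorial (w - j) : ℝ)) *
          (Real.Gamma ((j : ℝ) + (t : ℝ) - (s : ℝ) + 1))⁻¹ *
          (Nat.factorial (2 * j + 2 * t) / Nat.factorial (2 * j + 1)) * z ^ j := by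
        simp only [div_eq_mul_inv, mul_inv]; ring
    _ = ((-1 : ℝ) ^ j / (Nat.factorial (w - j) : ℝ)) *
          ((Nat.factorial (2 * j + 2 * t) : ℝ) /
            (Nat.factorial (j + t) * Nat.factorial (2 * j + 1))) *
          ((j + t).descFactorial s : ℝ) * z ^ j := by
        rw [h3]; simp only [div_eq_mul_inv, mul_inv]; ring
    _ = _ := by
        rw [e1, e2, coefA]; simp only [div_eq_mul_inv, mul_inv]; ring

theorem aux_vand (s t j : ℕ) :
    ((j + t).descFactorial s : ℝ) =
      ∑ k ∈ range (s + 1), (Nat.factorial s : ℝ) * (t.choose (s - k) : ℝ) * (j.choose k : ℝ) := by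
  rw [Nat.descFactorial_eq_factorial_mul_choose, Nat.add_choose_eq,
    Finset.Nat.sum_antidiagonal_eq_sum_range_succ_mk]
  push_cast
  rw [Finset.mul_sum]
  apply Finset.sum_congr rfl
  intros
  ring

theorem aux_shift (t w k : ℕ) (hk : k ≤ w) (z : ℝ) :
    ∑ j ∈ range (w + 1), (j.choose k : ℝ) * (coefA t w j * z ^ j) =
      coefA t w k * z ^ k * ∑ m ∈ range (w - k + 1),
          poch ((k : ℝ) - (w : ℝ)) m * poch (1 / 2 + (t : ℝ) + (k : ℝ)) m /
            poch (3 / 2 + (k : ℝ)) m * z ^ m / Nat.factorial m := by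
  rw [show w + 1 = k + (w - k + 1) by omega, Finset.sum_range_add, Finset.sum_eq_zero, zero_add,
    Finset.mul_sum]
  · apply Finset.sum_congr rfl
    intro m _
    have h := Nat.add_choose_mul_factorial_mul_factorial k m
    rw [Nat.choose_symm_add.symm] at h
    have h' : ((k + m).choose k : ℝ) * Nat.factorial k * Nat.factorial m
      = Nat.factorial (k + m) := by exact_mod_cast h
    have p1 : (0 : ℝ) < Nat.factorial k := by exact_mod_cast Nat.factorial_pos _
    have p2 : (0 : ℝ) < Nat.factorial m := by exact_mod_cast Nat.factorial_pos _
    have p3 : (0 : ℝ) < (k + m).choose k := by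
      exact_mod_cast Nat.choose_pos (Nat.le_add_right k m)
    have p4 := poch_pos' (3 / 2) (by norm_num) k
    have p5 := poch_pos' (3 / 2 + (k : ℝ)) (by positivity) m
    simp only [coefA, poch_add']
    rw [← h', show (k : ℝ) - w = -(w : ℝ) + k by ring, pow_add]
    field_simp
  · intro j hj
    rw [Nat.choose_eq_zero_of_lt (Finset.mem_range.1 hj)]
    simp


/-- statement (aa) of Lemma ff1: for `s ≥ 0`, `t ≥ 1`, `ω' ≥ 2t+s`
there are polynomials `Q_0, …, Q_s` with
`Σ_{j=0}^{ω'} (-1)^j (2j+2t)! z^j/((ω'-j)!(j+t-s)!(2j+1)!) = Σ_{k=0}^s Q_k(z) F_k(z)`,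
`F_k` the terminating hypergeometric sum `₂F₁(-ω'+k, 1/2+t+k; 3/2+k; z)`;
`1/(j+t-s)! = 1/Γ(j+t-s+1)` vanishes for `j+t-s < 0`. -/
theorem lemma_ff1_aa (s t ω' : ℕ) (ht : 1 ≤ t) (hω : 2 * t + s ≤ ω') :
    ∃ Q : ℕ → Polynomial ℝ, ∀ z : ℝ,
      ∑ j ∈ range (ω' + 1),
        ((-1 : ℝ) ^ j * (Nat.factorial (2 * j + 2 * t) : ℝ) * z ^ j /
          ((Nat.factorial (ω' - j) : ℝ) *
            Real.Gamma ((j : ℝ) + (t : ℝ) - (s : ℝ) + 1) * Nat.factorial (2 * j + 1))) =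
      ∑ k ∈ range (s + 1), (Q k).eval z *
        ∑ m ∈ range (ω' - k + 1),
          poch ((k : ℝ) - (ω' : ℝ)) m * poch (1 / 2 + (t : ℝ) + (k : ℝ)) m /
            poch (3 / 2 + (k : ℝ)) m * z ^ m / Nat.factorial m := by
  refine ⟨fun k => Polynomial.C ((Nat.factorial (2 * t) / (Nat.factorial t * Nat.factorial ω') : ℝ) *
    ((Nat.factorial s : ℝ) * (t.choose (s - k) : ℝ)) * coefA t ω' k) * Polynomial.X ^ k, fun z => ?_⟩
  rw [Finset.sum_congr rfl fun j hj =>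
    aux_term s t ω' j (Nat.lt_succ_iff.1 (Finset.mem_range.1 hj)) z]
  simp only [aux_vand, Finset.mul_sum (range (s + 1)), Finset.sum_mul (range (s + 1))]
  rw [Finset.sum_comm]
  apply Finset.sum_congr rfl
  intro k hk
  have hk' := Finset.mem_range.1 hk
  have h := aux_shift t ω' k (by omega) z
  rw [Polynomial.eval_mul, Polynomial.eval_C, Polynomial.eval_pow, Polynomial.eval_X]
  rw [mul_assoc, mul_assoc, ← mul_assoc (coefA t ω' k), ← h, ← mul_assoc, Finset.mul_sum]
  apply Finset.sum_congr rfl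
  intros
  ring
end
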